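/- arXiv:0905.1885 — 2 statements merged into one kernel-verified Lean document; each statement's English description precedes it below -/
import Mathlib

section
/- Let G = Z_{2^{λ_1}} × ⋯ × Z_{2^{λ_n}} with λ_1 ≤ λ_2 ≤ ⋯ ≤ λ_n. Then G has an irregular characteristic subgroup if and only if there exist indices i < j with λ_j − λ_i ≥ 2 such that neither exponent is repeated, i.e., λ_k ≠ λ_i for all k ≠ i and λ_k ≠ λ_j for all k ≠ j. -/
/-- A subgroup is characteristic if it is mapped onto itself by every automorphism. -/
def IsCharSub {G : Type*} [AddGroup G] (H : AddSubgroup G) : Prop :=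
  ∀ φ : AddAut G, AddSubgroup.map φ.toAddMonoidHom H = H

/-- The regular subgroup `R(a)`: elements whose `i`-th component is killed by `p ^ a i`. -/
def regSub (p : ℕ) {n : ℕ} (lam a : Fin n → ℕ) :
    AddSubgroup (Π i : Fin n, ZMod (p ^ lam i)) where
  carrier := {g | ∀ i, (p ^ a i : ℕ) • g i = 0}
  zero_mem' := by intro i; simp
  add_mem' := by
    intro x y hx hy i
    have : (p ^ a i : ℕ) • (x i + y i) = 0 := by
      rw [smul_add, hx i, hy i, add_zero]
    simpa using this
  neg_mem' := by
    intro x hx i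
    have : (p ^ a i : ℕ) • (-x i) = 0 := by
      rw [smul_neg, hx i, neg_zero]
    simpa using this

theorem ZMod.exists_two_pow_mul_isUnit (k : ℕ) (y : ZMod (2 ^ k)) :
    ∃ (u : ℕ) (v : ZMod (2 ^ k)), IsUnit v ∧ y = 2 ^ u * v := by
  by_cases hy : y = 0
  · refine ⟨k, 1, isUnit_one, ?_⟩
    have := ZMod.natCast_self (2 ^ k)
    push_cast at this
    simp [hy, this]
  · obtain ⟨u, m, hm, h⟩ := Nat.exists_eq_two_pow_mul_odd
      (n := y.val) (by simpa [ZMod.val_eq_zero] using hy)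
    refine ⟨u, (m : ZMod (2 ^ k)), ?_, ?_⟩
    · rw [ZMod.isUnit_iff_coprime]
      exact (hm.coprime_two_right).pow_right k
    · rw [← ZMod.natCast_zmod_val y, h]
      push_cast
      rfl

theorem ZMod.isUnit_or_two_dvd (k : ℕ) (y : ZMod (2 ^ k)) : IsUnit y ∨ 2 ∣ y := by
  obtain ⟨u, v, hv, rfl⟩ := ZMod.exists_two_pow_mul_isUnit k y
  rcases u with _ | u
  · left; simpa using hv
  · right; exact ⟨2 ^ u * v, by ring⟩

theorem ZMod.two_pow_dvd_total (k : ℕ) (y g : ZMod (2 ^ k)) : y ∣ g ∨ g ∣ y := by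
  obtain ⟨u, v, hv, rfl⟩ := ZMod.exists_two_pow_mul_isUnit k y
  obtain ⟨s, t, ht, rfl⟩ := ZMod.exists_two_pow_mul_isUnit k g
  rw [hv.mul_right_dvd, ht.mul_right_dvd, hv.dvd_mul_right, ht.dvd_mul_right]
  rcases le_total u s with h | h
  · left; exact pow_dvd_pow _ h
  · right; exact pow_dvd_pow _ h

theorem ZMod.dvd_of_two_pow_mul (k a : ℕ) (y g : ZMod (2 ^ k)) (hg : 2 ^ (a + 1) * g = 0)
    (hy : 2 ^ a * y ≠ 0) : y ∣ g := by
  rcases ZMod.two_pow_dvd_total k y g with h | ⟨c, rfl⟩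
  · exact h
  · rcases ZMod.isUnit_or_two_dvd k c with hc | ⟨d, rfl⟩
    · exact hc.mul_right_dvd.2 dvd_rfl
    · exact absurd (by linear_combination d * hg) hy

/-- In `ZMod (2 ^ k)`, two nonzero elements killed by `2` coincide. -/
theorem ZMod.add_eq_zero_of_two_mul (k : ℕ) (x y : ZMod (2 ^ k)) (hx : 2 * x = 0)
    (hy : 2 * y = 0) (hx0 : x ≠ 0) (hy0 : y ≠ 0) : x + y = 0 := by
  have hZ : ∀ e : ZMod 2, ¬ (IsUnit (e + 1) ∧ IsUnit e) := by decide
  obtain ⟨c, rfl⟩ := ZMod.dvd_of_two_pow_mul k 0 y x (by simpa using hx) (by simpa using hy0)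
  rcases ZMod.isUnit_or_two_dvd k (c + 1) with hc | ⟨d, hd⟩
  · rcases ZMod.isUnit_or_two_dvd k c with hc' | ⟨d, rfl⟩
    · rcases k with _ | k
      · exact Subsingleton.elim (α := ZMod 1) _ _
      · let f := ZMod.castHom (dvd_pow_self 2 k.succ_ne_zero) (ZMod 2)
        have h1 := hc.map f
        have h2 := hc'.map f
        rw [map_add, map_one] at h1
        exact absurd ⟨h1, h2⟩ (hZ (f c))
    · exact absurd (by linear_combination d * hy) hx0
  · linear_combination y * hd + d * hy

section

variable {n : ℕ} {lam : Fin n → ℕ}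

theorem AddSubgroup.single_mem_of_dvd {H : AddSubgroup (Π i : Fin n, ZMod (2 ^ lam i))} {i : Fin n}
    {y g : ZMod (2 ^ lam i)} (hy : Pi.single i y ∈ H) (h : y ∣ g) : Pi.single i g ∈ H := by
  obtain ⟨c, rfl⟩ := h
  have := H.nsmul_mem hy c.val
  rwa [← Pi.single_smul, nsmul_eq_mul, ZMod.natCast_zmod_val, mul_comm] at this

/-- The automorphism `x ↦ x + f (x i) e_j`. -/
def transvection {i j : Fin n} (hij : i ≠ j) (f : ZMod (2 ^ lam i) →+ ZMod (2 ^ lam j)) :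
    AddAut (Π i : Fin n, ZMod (2 ^ lam i)) where
  toFun x := x + Pi.single j (f (x i))
  invFun x := x - Pi.single j (f (x i))
  left_inv x := by simp [hij]
  right_inv x := by simp [hij]
  map_add' x y := by
    simp only [Pi.add_apply, map_add, Pi.single_add]
    abel

theorem IsCharSub.single_mem {H : AddSubgroup (Π i : Fin n, ZMod (2 ^ lam i))} (hH : IsCharSub H)
    {i j : Fin n} (hij : i ≠ j) (f : ZMod (2 ^ lam i) →+ ZMod (2 ^ lam j))
    {x : Π i : Fin n, ZMod (2 ^ lam i)} (hx : x ∈ H) : Pi.single j (f (x i)) ∈ H := by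
  have h : transvection hij f x ∈ H := by
    have := AddSubgroup.mem_map_of_mem (transvection hij f).toAddMonoidHom hx
    rwa [hH] at this
  exact (H.add_mem_cancel_left hx).1 h

theorem IsCharSub.single_mem_of_repeated {H : AddSubgroup (Π i : Fin n, ZMod (2 ^ lam i))}
    (hH : IsCharSub H) {i k : Fin n} (hik : i ≠ k) (h : lam k = lam i)
    {x : Π i : Fin n, ZMod (2 ^ lam i)} (hx : x ∈ H) : Pi.single i (x i) ∈ H := by
  let f : ZMod (2 ^ lam i) →+* ZMod (2 ^ lam k) := ZMod.castHom (by rw [h]) _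
  let g : ZMod (2 ^ lam k) →+* ZMod (2 ^ lam i) := ZMod.castHom (by rw [h]) _
  have h1 := hH.single_mem hik.symm (g : _ →+ _) (hH.single_mem hik (f : _ →+ _) hx)
  have h2 : g (f (x i)) = x i := by
    rw [← RingHom.comp_apply, Subsingleton.elim (g.comp f) (RingHom.id _), RingHom.id_apply]
  simpa [h2] using h1

theorem IsCharSub.single_mem_of_consecutive {H : AddSubgroup (Π i : Fin n, ZMod (2 ^ lam i))}
    (hH : IsCharSub H) {i j : Fin n} (hij : i ≠ j) (h : lam j = lam i + 1)
    {x : ZMod (2 ^ lam i)} {y : ZMod (2 ^ lam j)} (hxy : Pi.single i x + Pi.single j y ∈ H) :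
    Pi.single i x ∈ H ∧ Pi.single j y ∈ H := by
  suffices Pi.single i x ∈ H ∨ Pi.single j y ∈ H by
    rcases this with h | h
    · exact ⟨h, (H.add_mem_cancel_left h).1 hxy⟩
    · exact ⟨(H.add_mem_cancel_right h).1 hxy, h⟩
  let g : ZMod (2 ^ lam j) →+* ZMod (2 ^ lam i) := ZMod.castHom (pow_dvd_pow _ (by omega)) _
  let f : ZMod (2 ^ lam i) →+ ZMod (2 ^ lam j) := ZMod.lift (2 ^ lam i)
    ⟨(AddMonoidHom.mulLeft 2).comp (Int.castAddHom (ZMod (2 ^ lam j))), by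
      have : (2 : ZMod (2 ^ lam j)) * 2 ^ lam i = 0 := by
        rw [mul_comm]
        have h0 := ZMod.natCast_self (2 ^ lam j)
        push_cast at h0
        rwa [← pow_succ, ← h]
      simpa using this⟩
  have hf (m : ℕ) : f m = 2 * m := by
    rw [← Int.cast_natCast m, ZMod.lift_coe]
    simp
  have hg := hH.single_mem hij.symm (g : _ →+ _) hxy
  have hf' := hH.single_mem hij f hxy
  simp only [Pi.add_apply, Pi.single_eq_same, Pi.single_eq_of_ne hij, Pi.single_eq_of_ne hij.symm,
    add_zero, zero_add] at hg hf'
  have hleft (hd : y ∣ (x.val : ZMod (2 ^ lam j))) : Pi.single i x ∈ H := by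
    refine AddSubgroup.single_mem_of_dvd (y := g y) hg ?_
    have := map_dvd g hd
    rwa [map_natCast, ZMod.natCast_zmod_val] at this
  rcases ZMod.two_pow_dvd_total _ y (x.val : ZMod (2 ^ lam j)) with hd | ⟨c, hc⟩
  · exact Or.inl (hleft hd)
  · rcases ZMod.isUnit_or_two_dvd _ c with hu | ⟨d, rfl⟩
    · exact Or.inl (hleft (hc ▸ hu.mul_right_dvd.2 dvd_rfl))
    · right
      refine AddSubgroup.single_mem_of_dvd hf' ?_
      rw [← ZMod.natCast_zmod_val x, hf]
      exact ⟨d, by rw [hc]; ring⟩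

/-- A subgroup containing every coordinate component of each of its elements is regular. -/
theorem AddSubgroup.exists_eq_regSub {H : AddSubgroup (Π i : Fin n, ZMod (2 ^ lam i))}
    (hH : ∀ x ∈ H, ∀ i, Pi.single i (x i) ∈ H) :
    ∃ a : Fin n → ℕ, (∀ i, a i ≤ lam i) ∧ H = regSub 2 lam a := by
  classical
  have hex (i : Fin n) : ∃ k, ∀ y : ZMod (2 ^ lam i), Pi.single i y ∈ H → (2 ^ k : ℕ) • y = 0 :=
    ⟨lam i, fun y _ => by rw [nsmul_eq_mul, ZMod.natCast_self, zero_mul]⟩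
  refine ⟨fun i => Nat.find (hex i), fun i => Nat.find_min' _ fun y _ => ?_, ?_⟩
  · rw [nsmul_eq_mul, ZMod.natCast_self, zero_mul]
  ext x
  refine ⟨fun hx i => Nat.find_spec (hex i) _ (hH x hx i), fun hx => ?_⟩
  rw [← Finset.univ_sum_single x]
  refine H.sum_mem fun i _ => ?_
  have hxi : (2 ^ Nat.find (hex i) : ℕ) • x i = 0 := hx i
  rcases ha : Nat.find (hex i) with _ | a
  · rw [ha, pow_zero, one_smul] at hxi
    simp [hxi, H.zero_mem]
  · have hmin := Nat.find_min (hex i) (m := a) (by omega)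
    push Not at hmin
    obtain ⟨y, hyH, hy⟩ := hmin
    refine AddSubgroup.single_mem_of_dvd hyH (ZMod.dvd_of_two_pow_mul _ a y _ ?_ ?_)
    · rw [ha] at hxi
      simpa using hxi
    · simpa using hy

theorem IsCharSub.single_mem_of_gap_le_one
    {H : AddSubgroup (Π i : Fin n, ZMod (2 ^ lam i))} (hH : IsCharSub H)
    (hgap : ∀ i j, (∀ k, k ≠ i → lam k ≠ lam i) → (∀ k, k ≠ j → lam k ≠ lam j) →
      lam j ≤ lam i + 1) {x : Π i : Fin n, ZMod (2 ^ lam i)} (hx : x ∈ H) (i : Fin n) :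
    Pi.single i (x i) ∈ H := by
  have hrep (k : Fin n) (hk : ¬ ∀ l, l ≠ k → lam l ≠ lam k) : Pi.single k (x k) ∈ H := by
    push Not at hk
    obtain ⟨l, hlk, hl⟩ := hk
    exact hH.single_mem_of_repeated hlk.symm hl hx
  by_cases hi : ∀ k, k ≠ i → lam k ≠ lam i
  swap
  · exact hrep i hi
  have hsum := Finset.univ_sum_single x
  rw [← Finset.add_sum_erase _ _ (Finset.mem_univ i)] at hsum
  by_cases hj : ∃ j, j ≠ i ∧ ∀ k, k ≠ j → lam k ≠ lam j
  · obtain ⟨j, hji, hj⟩ := hj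
    rw [← Finset.add_sum_erase _ _ (Finset.mem_erase.2 ⟨hji, Finset.mem_univ j⟩), ← add_assoc]
      at hsum
    have hrest : ∑ k ∈ (Finset.univ.erase i).erase j, Pi.single k (x k) ∈ H := by
      refine H.sum_mem fun k hk => hrep k fun hk' => ?_
      simp only [Finset.mem_erase, Finset.mem_univ, and_true] at hk
      have := hgap i j hi hj
      have := hgap j i hj hi
      have := hgap i k hi hk'
      have := hgap k i hk' hi
      have := hgap j k hj hk'
      have := hgap k j hk' hj
      have := hi k hk.2
      have := hj k hk.1
      have := hi j hji
      omega
    have hij : Pi.single i (x i) + Pi.single j (x j) ∈ H :=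
      (H.add_mem_cancel_right hrest).1 (by rwa [hsum])
    have h1 := hgap i j hi hj
    have h2 := hgap j i hj hi
    have h3 := hi j hji
    rcases (by omega : lam j = lam i + 1 ∨ lam i = lam j + 1) with h | h
    · exact (hH.single_mem_of_consecutive hji.symm h hij).1
    · exact (hH.single_mem_of_consecutive hji h (by rwa [add_comm])).2
  · push Not at hj
    refine (H.add_mem_cancel_right (H.sum_mem (t := Finset.univ.erase i) fun k hk => hrep k ?_)).1
      (by rwa [hsum])
    push Not
    exact hj k (Finset.ne_of_mem_erase hk)

end

/-- Subgroups carried into themselves by every automorphism are characteristic. -/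
theorem isCharSub_of_forall_mem {G : Type*} [AddGroup G] {H : AddSubgroup G}
    (h : ∀ (φ : AddAut G), ∀ x ∈ H, φ x ∈ H) : IsCharSub H := by
  intro φ
  ext y
  refine ⟨?_, fun hy => ⟨φ.symm y, h φ.symm y hy, φ.apply_symm_apply y⟩⟩
  rintro ⟨x, hx, rfl⟩
  exact h φ x hx

theorem ZMod.two_pow_eq_zero {k m : ℕ} (h : k ≤ m) : (2 : ZMod (2 ^ k)) ^ m = 0 := by
  have := ZMod.natCast_self (2 ^ k)
  push_cast at this
  exact pow_eq_zero_of_le h this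

theorem ZMod.two_pow_ne_zero {k m : ℕ} (h : m < k) : (2 : ZMod (2 ^ k)) ^ m ≠ 0 := by
  intro h0
  have : ((2 ^ m : ℕ) : ZMod (2 ^ k)) = 0 := by exact_mod_cast h0
  rw [ZMod.natCast_eq_zero_iff, Nat.pow_dvd_pow_iff_le_right (by norm_num)] at this
  omega

theorem ZMod.two_pow_mul_eq_zero_iff {k m : ℕ} (h : m ≤ k) (x : ZMod (2 ^ k)) :
    2 ^ m * x = 0 ↔ 2 ^ (k - m) ∣ x := by
  constructor
  · intro hx
    rcases m with _ | m
    · simp_all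
    · refine ZMod.dvd_of_two_pow_mul k m _ x hx ?_
      rw [← pow_add]
      exact ZMod.two_pow_ne_zero (by omega)
  · rintro ⟨c, rfl⟩
    rw [← mul_assoc, ← pow_add, ZMod.two_pow_eq_zero (by omega), zero_mul]

/-- The elements `x` killed by `2 ^ (p + 1)` such that `2 ^ p • x` is divisible by
`2 ^ (q - 1)`, for which `2 ^ q` divides `2 ^ p • x` exactly when `2 ^ p` divides
`2 ^ (p - 1) • x`. -/
def IsDiagonal {G : Type*} [AddCommGroup G] (p q : ℕ) (x : G) : Prop :=
  2 ^ (p + 1) • x = 0 ∧ (∃ y : G, 2 ^ p • x = 2 ^ (q - 1) • y) ∧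
    ((∃ y : G, 2 ^ p • x = 2 ^ q • y) ↔ ∃ y : G, 2 ^ (p - 1) • x = 2 ^ p • y)

theorem IsDiagonal.map {G : Type*} [AddCommGroup G] {p q : ℕ} {x : G}
    (hx : IsDiagonal p q x) (φ : AddAut G) : IsDiagonal p q (φ x) := by
  have key (a b : ℕ) : (∃ y : G, a • φ x = b • y) ↔ ∃ y : G, a • x = b • y := by
    rw [φ.surjective.exists]
    simp only [← map_nsmul, φ.injective.eq_iff]
  unfold IsDiagonal at hx ⊢
  rw [key, key, key, ← map_nsmul, hx.1, map_zero]
  exact ⟨rfl, hx.2⟩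

section

variable {n : ℕ} {lam : Fin n → ℕ} {i j : Fin n}

theorem exists_nsmul_eq_iff (a b : ℕ) (x : Π i : Fin n, ZMod (2 ^ lam i)) :
    (∃ y : Π i : Fin n, ZMod (2 ^ lam i), 2 ^ a • x = 2 ^ b • y) ↔
      ∀ k, (2 : ZMod (2 ^ lam k)) ^ b ∣ 2 ^ a * x k := by
  constructor
  · rintro ⟨y, hy⟩ k
    exact ⟨y k, by simpa using congrFun hy k⟩
  · intro h
    choose y hy using h
    exact ⟨y, funext fun k => by simpa using hy k⟩

theorem nsmul_eq_zero_iff_forall (a : ℕ) (x : Π i : Fin n, ZMod (2 ^ lam i)) :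
    2 ^ a • x = 0 ↔ ∀ k, 2 ^ a * x k = 0 := by
  simp [funext_iff]

theorem isDiagonal_iff (hij : lam i + 2 ≤ lam j) (hpos : 1 ≤ lam i)
    (hi : ∀ k, k ≠ i → lam k ≠ lam i) (hj : ∀ k, k ≠ j → lam k ≠ lam j)
    (x : Π i : Fin n, ZMod (2 ^ lam i)) :
    IsDiagonal (lam i) (lam j) x ↔ (∀ k, 2 ^ (lam i + 1) * x k = 0) ∧
      (∀ k, (2 : ZMod (2 ^ lam k)) ^ (lam j - 1) ∣ 2 ^ lam i * x k) ∧
      (2 ^ lam i * x j = 0 ↔ 2 ^ (lam i - 1) * x i = 0) := by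
  unfold IsDiagonal
  simp only [exists_nsmul_eq_iff, nsmul_eq_zero_iff_forall]
  refine and_congr_right fun h1 => and_congr_right fun h2 => ?_
  have hjiff : (∀ k, (2 : ZMod (2 ^ lam k)) ^ lam j ∣ 2 ^ lam i * x k) ↔ 2 ^ lam i * x j = 0 := by
    refine ⟨fun h => ?_, fun h k => ?_⟩
    · simpa [ZMod.two_pow_eq_zero le_rfl] using h j
    · by_cases hk : k = j
      · subst hk
        simp [h]
      · rcases lt_or_gt_of_ne (hj k hk) with hlt | hgt
        · have := h2 k
          rw [ZMod.two_pow_eq_zero (by omega), zero_dvd_iff] at this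
          simp [this]
        · obtain ⟨c, hc⟩ := (ZMod.two_pow_mul_eq_zero_iff (by omega) _).1 (h1 k)
          rw [hc, ← mul_assoc, ← pow_add]
          exact Dvd.dvd.mul_right (pow_dvd_pow _ (by omega)) c
  have hiiff : (∀ k, (2 : ZMod (2 ^ lam k)) ^ lam i ∣ 2 ^ (lam i - 1) * x k) ↔
      2 ^ (lam i - 1) * x i = 0 := by
    refine ⟨fun h => ?_, fun h k => ?_⟩
    · simpa [ZMod.two_pow_eq_zero le_rfl] using h i
    · by_cases hk : k = i
      · subst hk
        simp [h]
      · rcases lt_or_gt_of_ne (hi k hk) with hlt | hgt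
        · simp [ZMod.two_pow_eq_zero (show lam k ≤ lam i - 1 by omega)]
        · have hev : ∃ m, 1 ≤ m ∧ (2 : ZMod (2 ^ lam k)) ^ m ∣ x k := by
            by_cases hk2 : lam k = lam i + 1
            · have := h2 k
              rw [ZMod.two_pow_eq_zero (by omega), zero_dvd_iff,
                ZMod.two_pow_mul_eq_zero_iff (by omega)] at this
              exact ⟨_, by omega, this⟩
            · exact ⟨_, by omega, (ZMod.two_pow_mul_eq_zero_iff (by omega) _).1 (h1 k)⟩
          obtain ⟨m, hm, c, hc⟩ := hev
          rw [hc, ← mul_assoc, ← pow_add]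
          exact Dvd.dvd.mul_right (pow_dvd_pow _ (by omega)) c
  rw [hjiff, hiiff]

/-- In a sum of two elements killed by `2`, vanishing behaves as for a functional to `ZMod 2`. -/
theorem ZMod.add_eq_zero_iff_of_two_mul (k : ℕ) (x y : ZMod (2 ^ k)) (hx : 2 * x = 0)
    (hy : 2 * y = 0) : x + y = 0 ↔ (x = 0 ↔ y = 0) := by
  by_cases hx0 : x = 0
  · simp [hx0]
  · by_cases hy0 : y = 0
    · simp [hy0]
    · simp [hx0, hy0, ZMod.add_eq_zero_of_two_mul k x y hx hy hx0 hy0]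

/-- The subgroup of elements satisfying `IsDiagonal`, written in coordinates. -/
def diagonalSubgroup (lam : Fin n → ℕ) (i j : Fin n) (hpos : 1 ≤ lam i) :
    AddSubgroup (Π i : Fin n, ZMod (2 ^ lam i)) where
  carrier := {x | (∀ k, 2 ^ (lam i + 1) * x k = 0) ∧
      (∀ k, (2 : ZMod (2 ^ lam k)) ^ (lam j - 1) ∣ 2 ^ lam i * x k) ∧
      (2 ^ lam i * x j = 0 ↔ 2 ^ (lam i - 1) * x i = 0)}
  zero_mem' := by simp
  add_mem' := by
    rintro x y ⟨hx1, hx2, hx3⟩ ⟨hy1, hy2, hy3⟩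
    refine ⟨fun k => ?_, fun k => ?_, ?_⟩
    · rw [Pi.add_apply, mul_add, hx1, hy1, add_zero]
    · rw [Pi.add_apply, mul_add]
      exact dvd_add (hx2 k) (hy2 k)
    · have hjk (z : ZMod (2 ^ lam j)) : 2 * (2 ^ lam i * z) = 2 ^ (lam i + 1) * z := by ring
      have hik (z : ZMod (2 ^ lam i)) : 2 * (2 ^ (lam i - 1) * z) = 0 := by
        rw [← mul_assoc, ← pow_succ', ZMod.two_pow_eq_zero (by omega), zero_mul]
      rw [Pi.add_apply, Pi.add_apply, mul_add, mul_add,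
        ZMod.add_eq_zero_iff_of_two_mul _ _ _ (by rw [hjk, hx1]) (by rw [hjk, hy1]),
        ZMod.add_eq_zero_iff_of_two_mul _ _ _ (hik _) (hik _), hx3, hy3]
  neg_mem' := by
    rintro x ⟨hx1, hx2, hx3⟩
    simp only [Set.mem_ofPred_eq, Pi.neg_apply, mul_neg, neg_eq_zero, dvd_neg]
    exact ⟨hx1, hx2, hx3⟩

theorem isCharSub_diagonalSubgroup (hij : lam i + 2 ≤ lam j) (hpos : 1 ≤ lam i)
    (hi : ∀ k, k ≠ i → lam k ≠ lam i) (hj : ∀ k, k ≠ j → lam k ≠ lam j) :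
    IsCharSub (diagonalSubgroup lam i j hpos) := by
  refine isCharSub_of_forall_mem fun φ x hx => ?_
  exact (isDiagonal_iff hij hpos hi hj _).1 (((isDiagonal_iff hij hpos hi hj x).2 hx).map φ)

theorem diagonalSubgroup_ne_regSub (hij : lam i + 2 ≤ lam j) (hpos : 1 ≤ lam i)
    (a : Fin n → ℕ) : diagonalSubgroup lam i j hpos ≠ regSub 2 lam a := by
  intro h
  have hne : i ≠ j := by
    rintro rfl
    omega
  have hmem : Pi.single i 1 + Pi.single j (2 ^ (lam j - lam i - 1)) ∈
      diagonalSubgroup lam i j hpos := by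
    refine ⟨fun k => ?_, fun k => ?_, ?_⟩
    · by_cases hki : k = i
      · subst hki
        rw [ZMod.two_pow_eq_zero (by omega), zero_mul]
      · by_cases hkj : k = j
        · subst hkj
          simp only [Pi.add_apply, Pi.single_eq_of_ne hki, Pi.single_eq_same, zero_add, ← pow_add]
          exact ZMod.two_pow_eq_zero (by omega)
        · simp [hki, hkj]
    · by_cases hki : k = i
      · subst hki
        rw [ZMod.two_pow_eq_zero le_rfl, zero_mul]
        exact dvd_zero _
      · by_cases hkj : k = j
        · subst hkj
          simp only [Pi.add_apply, Pi.single_eq_of_ne hki, Pi.single_eq_same, zero_add, ← pow_add]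
          exact pow_dvd_pow _ (by omega)
        · simp [hki, hkj]
    · simp only [Pi.add_apply, Pi.single_eq_of_ne hne, Pi.single_eq_of_ne hne.symm,
        Pi.single_eq_same, zero_add, add_zero, mul_one, ← pow_add]
      exact iff_of_false (ZMod.two_pow_ne_zero (by omega)) (ZMod.two_pow_ne_zero (by omega))
  have hsingle : Pi.single i 1 ∈ diagonalSubgroup lam i j hpos := by
    rw [h] at hmem ⊢
    intro k
    by_cases hki : k = i
    · subst hki
      simpa [Pi.single_eq_of_ne hne] using hmem k
    · simp [hki]
  have := hsingle.2.2.1 (by simp [hne.symm])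
  rw [Pi.single_eq_same, mul_one] at this
  exact ZMod.two_pow_ne_zero (by omega) this

end

theorem stmt_16 (n : ℕ) (hn : 0 < n) (lam : Fin n → ℕ)
    (hlam1 : ∀ i, 1 ≤ lam i) (hlam : Monotone lam) :
    (∃ H : AddSubgroup (Π i : Fin n, ZMod (2 ^ lam i)), IsCharSub H ∧
      ∀ a : Fin n → ℕ, (∀ i, a i ≤ lam i) → H ≠ regSub 2 lam a) ↔
    (∃ i j : Fin n, i < j ∧ lam i + 2 ≤ lam j ∧
      (∀ k, k ≠ i → lam k ≠ lam i) ∧ (∀ k, k ≠ j → lam k ≠ lam j)) := by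
  constructor
  · rintro ⟨H, hH, hirr⟩
    by_contra! hno
    obtain ⟨a, ha, hHa⟩ := AddSubgroup.exists_eq_regSub fun x hx =>
      hH.single_mem_of_gap_le_one (fun i j hi hj => by
        by_contra hgap
        obtain ⟨k, hk, hkj⟩ := hno i j (hlam.reflect_lt (by omega)) (by omega) hi
        exact hj k hk hkj) hx
    exact hirr a ha hHa
  · rintro ⟨i, j, -, hij, hi, hj⟩
    exact ⟨_, isCharSub_diagonalSubgroup hij (hlam1 i) hi hj,
      fun a _ => diagonalSubgroup_ne_regSub hij (hlam1 i) a⟩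
end

section
/- Let p be an odd prime and G = Z_{p^{λ_1}} × ⋯ × Z_{p^{λ_n}} with 0 < λ_1 < λ_2 < ⋯ < λ_n. Call a characteristic subgroup H of G join-irreducible if H ≠ {0} and, whenever H = K ⊔ L for characteristic subgroups K and L of G (⊔ the subgroup join), K = H or L = H. Then the poset of join-irreducible characteristic subgroups of G, ordered by inclusion, is self-dual: there exists an involution φ of the set of join-irreducible characteristic subgroups such that for all join-irreducible characteristic subgroups H and K, H ⊆ K if and only if φ(K) ⊆ φ(H). -/
/-- A characteristic subgroup is join-irreducible if it is nontrivial and is not the join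
of two characteristic subgroups other than itself. -/
def JoinIrredChar {G : Type*} [AddGroup G] (H : AddSubgroup G) : Prop :=
  IsCharSub H ∧ H ≠ ⊥ ∧
    ∀ K L : AddSubgroup G, IsCharSub K → IsCharSub L → H = K ⊔ L → K = H ∨ L = H

/-- A finite distributive lattice with an order-reversing involution has a self-dual poset of
join-irreducible elements. -/
theorem exists_involution_supIrred {T : Type*} [DistribLattice T] [BoundedOrder T] [Finite T]
    (d : T → T) (hd : Antitone d) (hdd : Function.Involutive d) :
    ∃ φ : {a : T // SupIrred a} → {a : T // SupIrred a},
      (∀ a, φ (φ a) = a) ∧ ∀ a b, a ≤ b ↔ φ b ≤ φ a := by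
  classical
  cases nonempty_fintype T
  have d_le {a b : T} : d a ≤ b ↔ d b ≤ a :=
    ⟨fun h => by simpa [hdd a] using hd h, fun h => by simpa [hdd b] using hd h⟩
  let m : T → T := fun j => (Finset.univ.filter fun a => ¬ j ≤ a).sup id
  have le_m {j : T} (hj : SupIrred j) (a : T) : a ≤ m j ↔ ¬ j ≤ a := by
    constructor
    · intro ha hja
      obtain ⟨c, hc, hjc⟩ := (supPrime_iff_supIrred.2 hj).le_finset_sup.1 (hja.trans ha)
      exact (Finset.mem_filter.1 hc).2 hjc
    · intro h
      exact Finset.le_sup (f := id) (Finset.mem_filter.2 ⟨Finset.mem_univ _, h⟩)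
  have key {j : T} (hj : SupIrred j) (b : T) : d (m j) ≤ b ↔ ¬ j ≤ d b := by
    rw [d_le, le_m hj]
  have irred {j : T} (hj : SupIrred j) : SupIrred (d (m j)) := by
    refine supPrime_iff_supIrred.1 ⟨fun hmin => ?_, fun {b c} hbc => ?_⟩
    · refine (key hj ⊥).1 (hmin.eq_bot.le) ?_
      have : (⊤ : T) ≤ d ⊥ := by simpa [hdd ⊤] using hd (bot_le : (⊥ : T) ≤ d ⊤)
      exact le_top.trans this
    · rw [key hj] at hbc ⊢
      rw [key hj]
      by_contra! h
      apply hbc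
      have : b ⊔ c ≤ d (d b ⊓ d c) :=
        sup_le (by simpa [hdd b] using hd (inf_le_left : d b ⊓ d c ≤ d b))
          (by simpa [hdd c] using hd (inf_le_right : d b ⊓ d c ≤ d c))
      exact (le_inf h.1 h.2).trans (by simpa [hdd (d b ⊓ d c)] using hd this)
  refine ⟨fun j => ⟨d (m j), irred j.2⟩, fun j => Subtype.ext ?_, fun j k => ?_⟩
  · refine eq_of_forall_ge_iff fun b => ?_
    change d (m (d (m j))) ≤ b ↔ _
    rw [key (irred j.2), key j.2, not_not, hdd b]
  · change j.1 ≤ k.1 ↔ d (m k) ≤ d (m j)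
    rw [key k.2, hdd, le_m j.2, not_not]

theorem IsCharSub.sup {G : Type*} [AddGroup G] {H K : AddSubgroup G}
    (hH : IsCharSub H) (hK : IsCharSub K) : IsCharSub (H ⊔ K) := fun φ => by
  rw [AddSubgroup.map_sup, hH φ, hK φ]

theorem IsCharSub.apply_mem {G : Type*} [AddGroup G] {H : AddSubgroup G}
    (hH : IsCharSub H) (φ : AddAut G) {x : G} (hx : x ∈ H) : φ x ∈ H := by
  rw [← hH φ]
  exact ⟨x, hx, rfl⟩

theorem isCharSub_of_apply_mem {G : Type*} [AddGroup G] {H : AddSubgroup G}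
    (h : ∀ φ : AddAut G, ∀ x ∈ H, φ x ∈ H) : IsCharSub H := by
  intro φ
  ext x
  constructor
  · rintro ⟨y, hy, rfl⟩
    exact h φ y hy
  · intro hx
    exact ⟨φ.symm x, h φ.symm x hx, φ.apply_symm_apply x⟩

/-- The transvection adding the image of the `i`-th coordinate to the `j`-th one. -/
def piTransvection {ι : Type*} [DecidableEq ι] {A : ι → Type*} [∀ i, AddCommGroup (A i)]
    {i j : ι} (hij : i ≠ j) (f : A i →+ A j) : AddAut (Π i, A i) where
  toFun x := x + Pi.single j (f (x i))
  invFun x := x - Pi.single j (f (x i))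
  left_inv x := by simp [Pi.single_eq_of_ne hij]
  right_inv x := by simp [Pi.single_eq_of_ne hij]
  map_add' x y := by simp only [Pi.add_apply, map_add, Pi.single_add]; abel

/-- The automorphism changing the sign of the `i`-th coordinate. -/
def piNegAt {ι : Type*} [DecidableEq ι] {A : ι → Type*} [∀ i, AddCommGroup (A i)]
    (i : ι) : AddAut (Π i, A i) where
  toFun x := x - 2 • Pi.single i (x i)
  invFun x := x - 2 • Pi.single i (x i)
  left_inv x := by
    ext k
    rcases eq_or_ne k i with rfl | h
    · simp [two_nsmul]
    · simp [Pi.single_eq_of_ne h]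
  right_inv x := by
    ext k
    rcases eq_or_ne k i with rfl | h
    · simp [two_nsmul]
    · simp [Pi.single_eq_of_ne h]
  map_add' x y := by simp only [Pi.add_apply, Pi.single_add, nsmul_add]; abel

theorem IsCharSub.single_hom_mem {ι : Type*} [DecidableEq ι] {A : ι → Type*}
    [∀ i, AddCommGroup (A i)] {H : AddSubgroup (Π i, A i)} (hH : IsCharSub H)
    {i j : ι} (hij : i ≠ j) (f : A i →+ A j) {x : Π i, A i} (hx : x ∈ H) :
    Pi.single j (f (x i)) ∈ H :=
  (H.add_mem_cancel_left hx).1 (hH.apply_mem (piTransvection hij f) hx)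

theorem IsCharSub.single_mem_s19 {ι : Type*} [DecidableEq ι] {A : ι → Type*}
    [∀ i, AddCommGroup (A i)] {H : AddSubgroup (Π i, A i)} (hH : IsCharSub H)
    {i : ι} {N : ℕ} (hN : Odd N) {x : Π i, A i} (hNx : N • x i = 0) (hx : x ∈ H) :
    Pi.single i (x i) ∈ H := by
  have h2 : 2 • Pi.single i (x i) ∈ H := by
    have := H.sub_mem hx (hH.apply_mem (piNegAt i) hx)
    simpa [piNegAt] using this
  obtain ⟨k, rfl⟩ := hN
  have hx0 : Pi.single i (x i) = -(k • 2 • Pi.single i (x i) : Π i, A i) := by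
    rw [eq_neg_iff_add_eq_zero, ← mul_nsmul, ← succ_nsmul', ← Pi.single_smul, hNx,
      Pi.single_zero]
  rw [hx0]
  exact H.neg_mem (H.nsmul_mem h2 k)

theorem ZMod.prime_pow_cast_eq_zero_iff {p : ℕ} (hp : p.Prime) (m k : ℕ) :
    ((p : ZMod (p ^ m)) ^ k = 0) ↔ m ≤ k := by
  rw [← Nat.cast_pow, ZMod.natCast_eq_zero_iff, Nat.pow_dvd_pow_iff_le_right hp.one_lt]

theorem ZMod.exists_eq_prime_pow_mul {p : ℕ} (hp : p.Prime) {m a : ℕ} (ha : a ≤ m)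
    {y : ZMod (p ^ m)} (hy : (p : ZMod (p ^ m)) ^ a * y = 0) :
    ∃ z : ℕ, y = (p ^ (m - a) * z : ℕ) := by
  have : NeZero (p ^ m) := ⟨(pow_pos hp.pos m).ne'⟩
  obtain ⟨y, rfl⟩ := ZMod.natCast_zmod_surjective y
  rw [← Nat.cast_pow, ← Nat.cast_mul, ZMod.natCast_eq_zero_iff] at hy
  obtain ⟨z, rfl⟩ : p ^ (m - a) ∣ y := by
    refine Nat.dvd_of_mul_dvd_mul_left (pow_pos hp.pos a) ?_
    rwa [← pow_add, Nat.add_sub_cancel' ha]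
  exact ⟨z, rfl⟩

theorem ZMod.exists_mem_iff_prime_pow_mul_eq_zero {p : ℕ} (hp : p.Prime) {m : ℕ}
    (H : AddSubgroup (ZMod (p ^ m))) :
    ∃ a ≤ m, ∀ x, x ∈ H ↔ (p : ZMod (p ^ m)) ^ a * x = 0 := by
  classical
  have : NeZero (p ^ m) := ⟨(pow_pos hp.pos m).ne'⟩
  have hex : ∃ a, ∀ x ∈ H, (p : ZMod (p ^ m)) ^ a * x = 0 :=
    ⟨m, fun x _ => by rw [(ZMod.prime_pow_cast_eq_zero_iff hp m m).2 le_rfl, zero_mul]⟩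
  have ham : Nat.find hex ≤ m := Nat.find_min' hex fun x _ => by
    rw [(ZMod.prime_pow_cast_eq_zero_iff hp m m).2 le_rfl, zero_mul]
  refine ⟨Nat.find hex, ham, fun y => ⟨Nat.find_spec hex y, fun hy => ?_⟩⟩
  rcases hb : Nat.find hex with _ | b
  · rw [hb, pow_zero, one_mul] at hy
    rw [hy]
    exact H.zero_mem
  · have hmin := Nat.find_min hex (m := b) (by omega)
    push Not at hmin
    obtain ⟨x, hx, hxb⟩ := hmin
    have hxa := Nat.find_spec hex x hx
    have hbm : b + 1 ≤ m := hb ▸ ham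
    obtain ⟨u, rfl⟩ := ZMod.exists_eq_prime_pow_mul hp ham hxa
    obtain ⟨w, rfl⟩ := ZMod.exists_eq_prime_pow_mul hp ham hy
    rw [hb] at hx hxb ⊢
    have hu : Nat.Coprime u (p ^ m) := by
      refine Nat.Coprime.pow_right _ ((Nat.coprime_comm.1 ?_))
      rw [hp.coprime_iff_not_dvd]
      rintro ⟨v, rfl⟩
      apply hxb
      have : (p : ZMod (p ^ m)) ^ m = 0 := (ZMod.prime_pow_cast_eq_zero_iff hp m m).2 le_rfl
      push_cast
      calc (p : ZMod (p ^ m)) ^ b * (p ^ (m - (b + 1)) * (p * v))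
          = p ^ (b + (m - (b + 1)) + 1) * v := by ring
        _ = 0 := by rw [show b + (m - (b + 1)) + 1 = m by omega, this, zero_mul]
    have hinv : (u : ZMod (p ^ m)) * (u : ZMod (p ^ m))⁻¹ = 1 :=
      ZMod.coe_mul_inv_eq_one u hu
    obtain ⟨c, hc⟩ := ZMod.natCast_zmod_surjective ((u : ZMod (p ^ m))⁻¹)
    have hmem := H.nsmul_mem hx (c * w)
    convert hmem using 1
    rw [nsmul_eq_mul]
    push_cast
    rw [hc]
    linear_combination (-(p : ZMod (p ^ m)) ^ (m - (b + 1)) * w) * hinv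

/-- The exponent sequences of the characteristic subgroups: the sequence `a` describes the product
of the subgroups of order `p ^ a i` of `ZMod (p ^ lam i)`. -/
def charExponents {n : ℕ} (lam : Fin n → ℕ) : Sublattice (Fin n → ℕ) where
  carrier := {a | (∀ i, a i ≤ lam i) ∧ ∀ i j, i < j → a i ≤ a j ∧ a j + lam i ≤ a i + lam j}
  supClosed' := by
    rintro a ⟨ha, ha'⟩ b ⟨hb, hb'⟩
    refine ⟨fun i => sup_le (ha i) (hb i), fun i j hij => ?_⟩
    have := ha' i j hij
    have := hb' i j hij
    simp only [Pi.sup_apply]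
    omega
  infClosed' := by
    rintro a ⟨ha, ha'⟩ b ⟨hb, hb'⟩
    refine ⟨fun i => inf_le_left.trans (ha i), fun i j hij => ?_⟩
    have := ha' i j hij
    have := hb' i j hij
    simp only [Pi.inf_apply]
    omega

/-- The subgroup of the elements whose `i`-th coordinate is killed by `p ^ a i`. -/
def expSubgroup (p : ℕ) {n : ℕ} (lam a : Fin n → ℕ) :
    AddSubgroup (Π i : Fin n, ZMod (p ^ lam i)) where
  carrier := {x | ∀ i, (p : ZMod (p ^ lam i)) ^ a i * x i = 0}
  add_mem' hx hy i := by simp [mul_add, hx i, hy i]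
  zero_mem' i := by simp
  neg_mem' hx i := by simp [hx i]

theorem mem_expSubgroup {p n : ℕ} {lam a : Fin n → ℕ} {x : Π i : Fin n, ZMod (p ^ lam i)} :
    x ∈ expSubgroup p lam a ↔ ∀ i, (p : ZMod (p ^ lam i)) ^ a i * x i = 0 := Iff.rfl

theorem single_mem_expSubgroup {p n : ℕ} {lam a : Fin n → ℕ} {i : Fin n}
    {y : ZMod (p ^ lam i)} :
    Pi.single i y ∈ expSubgroup p lam a ↔ (p : ZMod (p ^ lam i)) ^ a i * y = 0 := by
  refine ⟨fun h => by simpa using h i, fun h j => ?_⟩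
  rcases eq_or_ne j i with rfl | hj
  · simpa using h
  · simp [Pi.single_eq_of_ne hj]

theorem single_prime_pow_mem_expSubgroup {p n : ℕ} (hp : p.Prime) {lam a b : Fin n → ℕ}
    (ha : ∀ i, a i ≤ lam i) (i : Fin n) :
    Pi.single i ((p : ZMod (p ^ lam i)) ^ (lam i - a i)) ∈ expSubgroup p lam b ↔ a i ≤ b i := by
  rw [single_mem_expSubgroup, ← pow_add, ZMod.prime_pow_cast_eq_zero_iff hp]
  have := ha i
  omega

theorem expSubgroup_le_iff {p n : ℕ} (hp : p.Prime) {lam a b : Fin n → ℕ}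
    (ha : ∀ i, a i ≤ lam i) : expSubgroup p lam a ≤ expSubgroup p lam b ↔ a ≤ b := by
  constructor
  · intro h i
    exact (single_prime_pow_mem_expSubgroup hp ha i).1
      (h ((single_prime_pow_mem_expSubgroup hp ha i).2 le_rfl))
  · intro h x hx i
    rw [← Nat.sub_add_cancel (h i), pow_add, mul_assoc, hx i, mul_zero]

theorem isCharSub_expSubgroup {p n : ℕ} (hp : p.Prime) {lam a : Fin n → ℕ}
    (ha : a ∈ charExponents lam) : IsCharSub (expSubgroup p lam a) := by
  refine isCharSub_of_apply_mem fun φ x hx => ?_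
  rw [← Finset.univ_sum_single x, map_sum]
  refine AddSubgroup.sum_mem _ fun i _ j => ?_
  rw [← Nat.cast_pow, ← nsmul_eq_mul, ← Pi.smul_apply, ← map_nsmul, ← Pi.single_smul]
  rcases le_or_gt i j with hij | hij
  · have haij : a i ≤ a j := by
      rcases hij.eq_or_lt with rfl | h
      exacts [le_rfl, (ha.2 i j h).1]
    rw [nsmul_eq_mul, Nat.cast_pow, ← Nat.sub_add_cancel haij, pow_add, mul_assoc, hx i]
    simp
  · obtain ⟨z, hz⟩ := ZMod.exists_eq_prime_pow_mul hp (ha.1 i) (hx i)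
    have h1 : p ^ a j • x i = p ^ (a j + (lam i - a i)) • (z : ZMod (p ^ lam i)) := by
      rw [hz, nsmul_eq_mul, nsmul_eq_mul]
      push_cast
      ring
    rw [h1, Pi.single_smul, map_nsmul, Pi.smul_apply, nsmul_eq_mul, Nat.cast_pow,
      (ZMod.prime_pow_cast_eq_zero_iff hp _ _).2, zero_mul]
    have := ha.1 i
    have := (ha.2 j i hij).2
    omega

theorem IsCharSub.exists_eq_expSubgroup {p n : ℕ} (hp : p.Prime) (hodd : p ≠ 2)
    {lam : Fin n → ℕ} (hlam : StrictMono lam)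
    {H : AddSubgroup (Π i : Fin n, ZMod (p ^ lam i))} (hH : IsCharSub H) :
    ∃ a ∈ charExponents lam, expSubgroup p lam a = H := by
  choose a ha hmem using fun i => ZMod.exists_mem_iff_prime_pow_mul_eq_zero hp
    (H.comap (AddMonoidHom.single (fun i => ZMod (p ^ lam i)) i))
  have heq : expSubgroup p lam a = H := by
    ext x
    constructor
    · intro hx
      rw [← Finset.univ_sum_single x]
      exact H.sum_mem fun i _ => (hmem i (x i)).2 (hx i)
    · intro hx i
      refine (hmem i (x i)).1 (hH.single_mem_s19 ((hp.odd_of_ne_two hodd).pow (n := lam i)) ?_ hx)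
      rw [nsmul_eq_mul, ZMod.natCast_self, zero_mul]
  refine ⟨a, ⟨ha, fun i j hij => ?_⟩, heq⟩
  have hl := hlam hij
  have hgen (i : Fin n) : Pi.single i ((p : ZMod (p ^ lam i)) ^ (lam i - a i)) ∈ H :=
    heq ▸ (single_prime_pow_mem_expSubgroup hp ha i).2 le_rfl
  have transfer (i j : Fin n) (hij : i ≠ j) (k : ℕ) (hk : lam j ≤ lam i + k) :
      lam j ≤ a j + (lam i - a i) + k := by
    let f : ZMod (p ^ lam i) →+ ZMod (p ^ lam j) :=
      ZMod.lift (p ^ lam i) ⟨zmultiplesHom _ ((p : ZMod (p ^ lam j)) ^ k), by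
        simpa [← pow_add] using (ZMod.prime_pow_cast_eq_zero_iff hp _ _).2 hk⟩
    have hf (c : ℕ) : f c = c * (p : ZMod (p ^ lam j)) ^ k := by
      have := ZMod.lift_coe (p ^ lam i) ⟨zmultiplesHom _ ((p : ZMod (p ^ lam j)) ^ k), by
        simpa [← pow_add] using (ZMod.prime_pow_cast_eq_zero_iff hp _ _).2 hk⟩ (c : ℤ)
      simpa using this
    have h := hH.single_hom_mem hij f (hgen i)
    rw [← heq, Pi.single_eq_same, ← Nat.cast_pow, hf, single_mem_expSubgroup, Nat.cast_pow,
      ← pow_add, ← pow_add, ZMod.prime_pow_cast_eq_zero_iff hp] at h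
    omega
  have h1 := transfer i j hij.ne (lam j - lam i) (by omega)
  have h2 := transfer j i hij.ne' 0 (by omega)
  have := ha i
  have := ha j
  omega

theorem joinIrredChar_expSubgroup_iff {p n : ℕ} (hp : p.Prime) (hodd : p ≠ 2)
    {lam : Fin n → ℕ} (hlam : StrictMono lam) (a : charExponents lam) :
    JoinIrredChar (expSubgroup p lam a) ↔ SupIrred a := by
  have le_iff (a b : charExponents lam) :
      expSubgroup p lam a ≤ expSubgroup p lam b ↔ a ≤ b := expSubgroup_le_iff hp a.2.1
  have inj (a b : charExponents lam) (h : expSubgroup p lam a = expSubgroup p lam b) : a = b :=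
    le_antisymm ((le_iff a b).1 h.le) ((le_iff b a).1 h.ge)
  have map_sup (a b : charExponents lam) :
      expSubgroup p lam (a ⊔ b : charExponents lam) =
        expSubgroup p lam a ⊔ expSubgroup p lam b := by
    refine le_antisymm ?_ (sup_le ((le_iff _ _).2 le_sup_left) ((le_iff _ _).2 le_sup_right))
    obtain ⟨c, hc, hceq⟩ := ((isCharSub_expSubgroup hp a.2).sup
      (isCharSub_expSubgroup hp b.2)).exists_eq_expSubgroup hp hodd hlam
    rw [← hceq]
    refine (le_iff _ ⟨c, hc⟩).2 (sup_le ((le_iff _ ⟨c, hc⟩).1 ?_) ((le_iff _ ⟨c, hc⟩).1 ?_))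
    · exact hceq ▸ le_sup_left
    · exact hceq ▸ le_sup_right
  have bot_iff : expSubgroup p lam a = ⊥ ↔ IsMin a := by
    constructor
    · intro h b _
      exact (le_iff a b).1 (h ▸ bot_le)
    · intro h
      obtain ⟨c, hc, hceq⟩ := IsCharSub.exists_eq_expSubgroup (p := p) hp hodd hlam
        (H := ⊥) (fun φ => AddSubgroup.map_bot _)
      have hca : (⟨c, hc⟩ : charExponents lam) ≤ a := (le_iff ⟨c, hc⟩ a).1 (hceq ▸ bot_le)
      exact le_bot_iff.1 (hceq ▸ (le_iff a ⟨c, hc⟩).2 (h hca))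
  constructor
  · rintro ⟨-, hbot, hirr⟩
    refine ⟨fun h => hbot (bot_iff.2 h), fun b c hbc => ?_⟩
    exact (hirr _ _ (isCharSub_expSubgroup hp b.2) (isCharSub_expSubgroup hp c.2)
      (by rw [← map_sup, hbc])).imp (inj _ _) (inj _ _)
  · rintro ⟨hmin, hirr⟩
    refine ⟨isCharSub_expSubgroup hp a.2, fun h => hmin (bot_iff.1 h), fun K L hK hL h => ?_⟩
    obtain ⟨b, hb, rfl⟩ := hK.exists_eq_expSubgroup hp hodd hlam
    obtain ⟨c, hc, rfl⟩ := hL.exists_eq_expSubgroup hp hodd hlam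
    have hbc := inj _ _ ((map_sup ⟨b, hb⟩ ⟨c, hc⟩).trans h.symm)
    exact (hirr hbc).imp (fun h => by rw [← h]) (fun h => by rw [← h])

theorem exists_involution_supIrred_charExponents {n : ℕ} {lam : Fin n → ℕ}
    (hlam : Monotone lam) :
    ∃ φ : {a : charExponents lam // SupIrred a} → {a : charExponents lam // SupIrred a},
      (∀ a, φ (φ a) = a) ∧ ∀ a b, a ≤ b ↔ φ b ≤ φ a := by
  let _ : BoundedOrder (charExponents lam) :=
    { bot := ⟨0, fun i => Nat.zero_le _, fun i j hij => by simpa using hlam hij.le⟩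
      bot_le := fun a i => Nat.zero_le _
      top := ⟨lam, fun i => le_rfl, fun i j hij => ⟨hlam hij.le, by omega⟩⟩
      le_top := fun a => a.2.1 }
  have : Finite (charExponents lam) :=
    ((Set.finite_Iic lam).subset fun a (ha : a ∈ charExponents lam) => ha.1).to_subtype
  refine exists_involution_supIrred
    (fun a => ⟨lam - a.1, fun i => Nat.sub_le _ _, fun i j hij => ?_⟩) ?_ ?_
  · have := a.2.2 i j hij
    have := a.2.1 i
    have := a.2.1 j
    have := hlam hij.le
    simp only [Pi.sub_apply]
    omega
  · intro a b hab i
    exact Nat.sub_le_sub_left (hab i) _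
  · intro a
    ext i
    exact Nat.sub_sub_self (a.2.1 i)

theorem stmt_19 (p : ℕ) (hp : p.Prime) (hodd : p ≠ 2) (n : ℕ)
    (lam : Fin n → ℕ) (hlam0 : ∀ i, 0 < lam i) (hlam : StrictMono lam) :
    ∃ φ : {H : AddSubgroup (Π i : Fin n, ZMod (p ^ lam i)) // JoinIrredChar H} →
        {H : AddSubgroup (Π i : Fin n, ZMod (p ^ lam i)) // JoinIrredChar H},
      (∀ H, φ (φ H) = H) ∧ (∀ H K, H ≤ K ↔ φ K ≤ φ H) := by
  obtain ⟨φ, hφ, hle⟩ := exists_involution_supIrred_charExponents hlam.monotone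
  let f : {a : charExponents lam // SupIrred a} ↪o
      {H : AddSubgroup (Π i : Fin n, ZMod (p ^ lam i)) // JoinIrredChar H} :=
    OrderEmbedding.ofMapLEIff
      (fun a => ⟨expSubgroup p lam a, (joinIrredChar_expSubgroup_iff hp hodd hlam a).2 a.2⟩)
      fun a _ => expSubgroup_le_iff hp a.1.2.1
  have hf : Function.Surjective f := by
    rintro ⟨H, hH⟩
    obtain ⟨a, ha, rfl⟩ := hH.1.exists_eq_expSubgroup hp hodd hlam
    exact ⟨⟨⟨a, ha⟩, (joinIrredChar_expSubgroup_iff hp hodd hlam ⟨a, ha⟩).1 hH⟩, rfl⟩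
  let e := RelIso.ofSurjective f hf
  refine ⟨fun H => e (φ (e.symm H)), fun H => by simp [hφ], fun H K => ?_⟩
  rw [OrderIso.le_iff_le, ← hle, OrderIso.le_iff_le]
end
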